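/- Let l ≥ 1 and R ≥ r > 0. Define f : ℝ^{2l} × ℝ^{2l} → ℝ by f(x, y) = max_{m : Fin l} ∠(x_m, y_m). Then f is Lipschitz on K(R,r) × K(R,r): there exists L ≥ 0 such that for all x, y, x', y' ∈ K(R,r), |f(x, y) − f(x', y')| ≤ L · (‖x − x'‖ + ‖y − y'‖). -/

import Mathlib

open Real Matrix

open scoped RealInnerProductSpace

noncomputable section

instance : Fact (Module.finrank ℝ (EuclideanSpace ℝ (Fin 2)) = 2) :=
  ⟨finrank_euclideanSpace_fin⟩

/-- The standard orientation of the Euclidean plane `EuclideanSpace ℝ (Fin 2)`. -/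
def stdOrient : Orientation ℝ (EuclideanSpace ℝ (Fin 2)) (Fin 2) :=
  (EuclideanSpace.basisFun (Fin 2) ℝ).toBasis.orientation

/-- Oriented angle from `u` to `v` w.r.t. the standard orientation
(`0` if `u = 0` or `v = 0`). -/
def oangle (u v : EuclideanSpace ℝ (Fin 2)) : Real.Angle := stdOrient.oangle u v

/-- Counterclockwise rotation of the plane by angle `θ`, i.e. the linear isometry with
matrix `[[cos θ, −sin θ], [sin θ, cos θ]]` in the standard basis. -/
def rot (θ : ℝ) (u : EuclideanSpace ℝ (Fin 2)) : EuclideanSpace ℝ (Fin 2) :=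
  (WithLp.equiv 2 (Fin 2 → ℝ)).symm
    ![Real.cos θ * u 0 - Real.sin θ * u 1, Real.sin θ * u 0 + Real.cos θ * u 1]

/-- The `m`-th coordinate block (in `ℝ²`) of a vector in `ℝ^{2l}`. -/
def blk {l : ℕ} (q : EuclideanSpace ℝ (Fin l × Fin 2)) (m : Fin l) :
    EuclideanSpace ℝ (Fin 2) :=
  (WithLp.equiv 2 (Fin 2 → ℝ)).symm fun i => q (m, i)

/-- The `m`-th coordinate block (in `ℝ²`) of a plain vector `Fin l × Fin 2 → ℝ`. -/
def blkF {l : ℕ} (q : Fin l × Fin 2 → ℝ) (m : Fin l) : EuclideanSpace ℝ (Fin 2) :=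
  (WithLp.equiv 2 (Fin 2 → ℝ)).symm fun i => q (m, i)

/-- The 2×2 rotation matrix by angle `θ`. -/
def rotMat (θ : ℝ) : Matrix (Fin 2) (Fin 2) ℝ :=
  !![Real.cos θ, -Real.sin θ; Real.sin θ, Real.cos θ]

/-- The `(2l)×(2l)` block-diagonal RoPE matrix whose `m`-th `2×2` diagonal block is the
rotation matrix by angle `δ m v`. -/
def RoPE {l : ℕ} (δ : Fin l → (EuclideanSpace ℝ (Fin 3) →ₗ[ℝ] ℝ))
    (v : EuclideanSpace ℝ (Fin 3)) : Matrix (Fin l × Fin 2) (Fin l × Fin 2) ℝ :=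
  fun p q => if p.1 = q.1 then rotMat (δ p.1 v) p.2 q.2 else 0

/-- `K(R,r)`: vectors of norm at most `R` all of whose coordinates have absolute
value at least `r`. -/
def K (l : ℕ) (R r : ℝ) : Set (EuclideanSpace ℝ (Fin l × Fin 2)) :=
  {q | ‖q‖ ≤ R ∧ ∀ i, r ≤ |q i|}


/-- Vectors of norm at least `r` at distance `d` enclose an angle of at most `π / (2 * r) * d`. -/
theorem angle_le_mul_norm_sub {V : Type*} [NormedAddCommGroup V] [InnerProductSpace ℝ V]
    {r : ℝ} (hr : 0 < r) {u v : V} (hu : r ≤ ‖u‖) (hv : r ≤ ‖v‖) :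
    InnerProductGeometry.angle u v ≤ π / (2 * r) * ‖u - v‖ := by
  have h0 := InnerProductGeometry.angle_nonneg u v
  have hcos := Real.cos_le_one_sub_mul_cos_sq
    (abs_le.2 ⟨by linarith [Real.pi_pos], InnerProductGeometry.angle_le_pi u v⟩)
  have hlaw :=
    InnerProductGeometry.norm_sub_sq_eq_norm_sq_add_norm_sq_sub_two_mul_norm_mul_norm_mul_cos_angle
      u v
  set θ := InnerProductGeometry.angle u v
  have hprod : r * r ≤ ‖u‖ * ‖v‖ := mul_le_mul hu hv hr.le (norm_nonneg u)
  have hone : 0 ≤ 1 - Real.cos θ := by linarith [Real.cos_le_one θ]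
  have hdist : r * r * (2 * (1 - Real.cos θ)) ≤ ‖u - v‖ * ‖u - v‖ := by
    nlinarith [sq_nonneg (‖u‖ - ‖v‖), mul_le_mul_of_nonneg_right hprod hone]
  have hsq : (2 * r / π * θ) ^ 2 ≤ ‖u - v‖ ^ 2 := by
    calc (2 * r / π * θ) ^ 2 = r * r * (2 * (2 / π ^ 2 * θ ^ 2)) := by ring
      _ ≤ r * r * (2 * (1 - Real.cos θ)) := by gcongr; linarith
      _ ≤ ‖u - v‖ ^ 2 := by rw [sq]; exact hdist
  have hle := le_of_sq_le_sq hsq (norm_nonneg _)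
  calc θ = π / (2 * r) * (2 * r / π * θ) := by field_simp
    _ ≤ π / (2 * r) * ‖u - v‖ := by gcongr

theorem norm_blk_sub_le {l : ℕ} (x y : EuclideanSpace ℝ (Fin l × Fin 2)) (m : Fin l) :
    ‖blk x m - blk y m‖ ≤ ‖x - y‖ := by
  refine le_of_sq_le_sq ?_ (norm_nonneg _)
  rw [EuclideanSpace.real_norm_sq_eq, EuclideanSpace.real_norm_sq_eq, Fintype.sum_prod_type]
  exact Finset.single_le_sum (f := fun k => ∑ i, (x - y) (k, i) ^ 2)
    (fun k _ => Finset.sum_nonneg fun i _ => sq_nonneg _) (Finset.mem_univ m)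

theorem le_norm_blk {l : ℕ} {R r : ℝ} {x : EuclideanSpace ℝ (Fin l × Fin 2)} (hx : x ∈ K l R r)
    (m : Fin l) : r ≤ ‖blk x m‖ :=
  (hx.2 (m, 0)).trans (PiLp.norm_apply_le (blk x m) 0)

theorem angle_blk_le {l : ℕ} {R r : ℝ} (hr : 0 < r)
    {x y x' y' : EuclideanSpace ℝ (Fin l × Fin 2)}
    (hx : x ∈ K l R r) (hy : y ∈ K l R r) (hx' : x' ∈ K l R r) (hy' : y' ∈ K l R r) (m : Fin l) :
    InnerProductGeometry.angle (blk x m) (blk y m) ≤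
      InnerProductGeometry.angle (blk x' m) (blk y' m) +
        π / (2 * r) * (‖x - x'‖ + ‖y - y'‖) := by
  have h₁ := InnerProductGeometry.angle_le_angle_add_angle (blk x m) (blk x' m) (blk y m)
  have h₂ := InnerProductGeometry.angle_le_angle_add_angle (blk x' m) (blk y' m) (blk y m)
  have h₃ : InnerProductGeometry.angle (blk x m) (blk x' m) ≤ π / (2 * r) * ‖x - x'‖ :=
    (angle_le_mul_norm_sub hr (le_norm_blk hx m) (le_norm_blk hx' m)).trans
      (by gcongr; exact norm_blk_sub_le x x' m)
  have h₄ : InnerProductGeometry.angle (blk y' m) (blk y m) ≤ π / (2 * r) * ‖y - y'‖ := by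
    rw [InnerProductGeometry.angle_comm]
    exact (angle_le_mul_norm_sub hr (le_norm_blk hy m) (le_norm_blk hy' m)).trans
      (by gcongr; exact norm_blk_sub_le y y' m)
  linarith

theorem finset_sup_le_sup_add {ι : Type*} {s : Finset ι} (hs : s.Nonempty) {f g : ι → ℝ} {c : ℝ}
    (h : ∀ i ∈ s, f i ≤ g i + c) : s.sup' hs f ≤ s.sup' hs g + c :=
  Finset.sup'_le hs f fun i hi => (h i hi).trans (by gcongr; exact Finset.le_sup' g hi)

/-- the function `f(x, y) = max_m ∠(x_m, y_m)` is Lipschitz on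
`K(R,r) × K(R,r)`. -/
theorem stmt5 {l : ℕ} (hl : 1 ≤ l) (R r : ℝ) (hr : 0 < r) (hRr : r ≤ R) :
    ∃ L : ℝ, 0 ≤ L ∧ ∀ x y x' y' : EuclideanSpace ℝ (Fin l × Fin 2),
      x ∈ K l R r → y ∈ K l R r → x' ∈ K l R r → y' ∈ K l R r →
      |Finset.univ.sup' ⟨⟨0, hl⟩, Finset.mem_univ _⟩
          (fun m : Fin l => InnerProductGeometry.angle (blk x m) (blk y m)) -
        Finset.univ.sup' ⟨⟨0, hl⟩, Finset.mem_univ _⟩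
          (fun m : Fin l => InnerProductGeometry.angle (blk x' m) (blk y' m))| ≤
      L * (‖x - x'‖ + ‖y - y'‖) := by
  refine ⟨π / (2 * r), by positivity, fun x y x' y' hx hy hx' hy' => abs_sub_le_iff.2 ⟨?_, ?_⟩⟩
  · exact sub_le_iff_le_add'.2
      (finset_sup_le_sup_add _ fun m _ => angle_blk_le hr hx hy hx' hy' m)
  · rw [norm_sub_rev x, norm_sub_rev y]
    exact sub_le_iff_le_add'.2
      (finset_sup_le_sup_add _ fun m _ => angle_blk_le hr hx' hy' hx hy m)

end
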